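/- Let F and G be smooth cubics in ℂ[X,Y,Z] whose common projective zero set consists of exactly nine distinct points p₁,…,p₉ of ℙ², with F and G meeting transversally at each of these points. If H is any cubic that vanishes at eight of the nine points p₁,…,p₉, then H also vanishes at the ninth point. -/

import Mathlib

open MvPolynomial

/-- The gradient of a polynomial in `ℂ[X,Y,Z]` at a point of `ℂ³`. -/
noncomputable def grad (F : MvPolynomial (Fin 3) ℂ) (v : Fin 3 → ℂ) : Fin 3 → ℂ :=
  fun i => eval v (pderiv i F)

/-- A cubic: a nonzero homogeneous polynomial of degree 3 in `ℂ[X,Y,Z]`. -/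
def IsCubic (F : MvPolynomial (Fin 3) ℂ) : Prop :=
  F ≠ 0 ∧ F.IsHomogeneous 3

/-- A smooth cubic: `(0,0,0)` is the only common zero in `ℂ³` of the three
partial derivatives. -/
def SmoothCubic (F : MvPolynomial (Fin 3) ℂ) : Prop :=
  IsCubic F ∧ ∀ v : Fin 3 → ℂ, grad F v = 0 → v = 0

/-- `F` and `G` meet transversally at (the projective point represented by) `v`:
their gradients at `v` are linearly independent over `ℂ`. -/
def Transverse (F G : MvPolynomial (Fin 3) ℂ) (v : Fin 3 → ℂ) : Prop :=
  LinearIndependent ℂ ![grad F v, grad G v]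

/-- Two nonzero vectors of `ℂ³` represent the same point of `ℙ²`. -/
def SameProjPt (u v : Fin 3 → ℂ) : Prop :=
  ∃ c : ℂ, c ≠ 0 ∧ c • u = v

/-- The common projective zero set of `F` and `G` consists of exactly the nine
distinct points of `ℙ²` represented by `p 0, …, p 8`. -/
def NinePoints (F G : MvPolynomial (Fin 3) ℂ) (p : Fin 9 → Fin 3 → ℂ) : Prop :=
  (∀ i, p i ≠ 0) ∧
  (∀ i j, i ≠ j → ¬ SameProjPt (p i) (p j)) ∧
  (∀ i, eval (p i) F = 0 ∧ eval (p i) G = 0) ∧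
  (∀ v : Fin 3 → ℂ, v ≠ 0 → eval v F = 0 → eval v G = 0 → ∃ i, SameProjPt (p i) v)

section Geometry

open Matrix

theorem exists_eq_smul_add_smul_of_dotProduct_cross {x y v : Fin 3 → ℂ} (hxy : x ⨯₃ y ≠ 0)
    (hv : v ⬝ᵥ x ⨯₃ y = 0) : ∃ a b : ℂ, v = a • x + b • y := by
  obtain ⟨m, hm⟩ := Function.ne_iff.mp hxy
  refine ⟨(v ⨯₃ y) m / (x ⨯₃ y) m, (x ⨯₃ v) m / (x ⨯₃ y) m, ?_⟩
  simp only [Pi.zero_apply] at hm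
  ext k
  simp only [Pi.add_apply, Pi.smul_apply, smul_eq_mul]
  field_simp
  simp only [vec3_dotProduct, cross_apply] at hv ⊢
  fin_cases m <;> fin_cases k <;> simp at hv ⊢ <;> grind

theorem eq_smul_cross_of_dotProduct {x y a : Fin 3 → ℂ}
    (hx : a ⬝ᵥ x = 0) (hy : a ⬝ᵥ y = 0) {m : Fin 3} (hm : (x ⨯₃ y) m ≠ 0) :
    a = (a m / (x ⨯₃ y) m) • (x ⨯₃ y) := by
  ext k
  simp only [Pi.smul_apply, smul_eq_mul]
  field_simp
  simp only [vec3_dotProduct, cross_apply] at hx hy ⊢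
  fin_cases m <;> fin_cases k <;> simp at hx hy ⊢ <;> grind

theorem cross_ne_zero_of_not_sameProjPt {x y : Fin 3 → ℂ} (hx : x ≠ 0) (hy : y ≠ 0)
    (h : ¬ SameProjPt x y) : x ⨯₃ y ≠ 0 := by
  rw [crossProduct_ne_zero_iff_linearIndependent, LinearIndependent.pair_iff' hx]
  rintro a rfl
  exact h ⟨a, by rintro rfl; simp at hy, rfl⟩

end Geometry

section Line

open Matrix

/-- The restriction of `P` to the line `t ↦ x + t y`. -/
noncomputable def lineRestrict (x y : Fin 3 → ℂ) : MvPolynomial (Fin 3) ℂ →ₐ[ℂ] Polynomial ℂ :=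
  aeval fun i => Polynomial.C (x i) + Polynomial.C (y i) * Polynomial.X

theorem eval_lineRestrict (x y : Fin 3 → ℂ) (P : MvPolynomial (Fin 3) ℂ) (t : ℂ) :
    (lineRestrict x y P).eval t = eval (x + t • y) P := by
  induction P using MvPolynomial.induction_on with
  | C a => simp [lineRestrict]
  | add p q hp hq => simp [hp, hq]
  | mul_X p i hp => simp [hp]; simp [lineRestrict]; left; ring

theorem derivative_lineRestrict (x y : Fin 3 → ℂ) (P : MvPolynomial (Fin 3) ℂ) :
    (lineRestrict x y P).derivative =
      ∑ i, Polynomial.C (y i) * lineRestrict x y (pderiv i P) := by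
  induction P using MvPolynomial.induction_on with
  | C a => simp [lineRestrict]
  | add p q hp hq => simp [hp, hq, mul_add, Finset.sum_add_distrib]
  | mul_X p i hp =>
    have hX (j : Fin 3) : lineRestrict x y (X j) =
      Polynomial.C (x j) + Polynomial.C (y j) * Polynomial.X := by simp [lineRestrict]
    simp only [map_mul, Polynomial.derivative_mul, hp, Derivation.leibniz, pderiv_X, smul_eq_mul,
      map_add, hX, Fin.sum_univ_three]
    fin_cases i <;> simp <;> ring

theorem sum_exponents_eq_of_isHomogeneous {P : MvPolynomial (Fin 3) ℂ} {n : ℕ}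
    (hP : P.IsHomogeneous n) {d : Fin 3 →₀ ℕ} (hd : d ∈ P.support) : d 0 + d 1 + d 2 = n := by
  rw [← Fin.sum_univ_three, hP.degree_eq_sum_deg_support hd]
  exact (Finset.sum_subset (Finset.subset_univ _) (by simp)).symm

theorem natDegree_lineRestrict_le_and_coeff {P : MvPolynomial (Fin 3) ℂ} {n : ℕ}
    (hP : P.IsHomogeneous n) (x y : Fin 3 → ℂ) :
    (lineRestrict x y P).natDegree ≤ n ∧ (lineRestrict x y P).coeff n = eval y P := by
  have hlin (i : Fin 3) :
      (Polynomial.C (x i) + Polynomial.C (y i) * Polynomial.X : Polynomial ℂ).natDegree ≤ 1 := by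
    compute_degree
  have hmon : ∀ d ∈ P.support,
      (lineRestrict x y (monomial d (P.coeff d))).natDegree ≤ n ∧
      (lineRestrict x y (monomial d (P.coeff d))).coeff n =
        eval y (monomial d (P.coeff d)) := by
    intro d hd
    have hn := sum_exponents_eq_of_isHomogeneous hP hd
    have hpow (i : Fin 3) : ((Polynomial.C (x i) + Polynomial.C (y i) * Polynomial.X) ^ d i :
        Polynomial ℂ).natDegree ≤ d i := by
      simpa using Polynomial.natDegree_pow_le_of_le (d i) (hlin i)
    have hcoe (i : Fin 3) : ((Polynomial.C (x i) + Polynomial.C (y i) * Polynomial.X) ^ d i :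
        Polynomial ℂ).coeff (d i) = y i ^ d i := by
      simpa using Polynomial.coeff_pow_of_natDegree_le (m := d i) (hlin i)
    have h01 := Polynomial.natDegree_mul_le_of_le (hpow 0) (hpow 1)
    have h012 := Polynomial.natDegree_mul_le_of_le h01 (hpow 2)
    have e : lineRestrict x y (monomial d (P.coeff d)) = Polynomial.C (P.coeff d) *
        (((Polynomial.C (x 0) + Polynomial.C (y 0) * Polynomial.X) ^ d 0 *
        (Polynomial.C (x 1) + Polynomial.C (y 1) * Polynomial.X) ^ d 1) *
        (Polynomial.C (x 2) + Polynomial.C (y 2) * Polynomial.X) ^ d 2) := by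
      rw [lineRestrict, aeval_monomial, Finsupp.prod_fintype _ _ (by simp), Fin.prod_univ_three]
      rfl
    rw [e, ← hn]
    refine ⟨(Polynomial.natDegree_C_mul_le _ _).trans h012, ?_⟩
    rw [Polynomial.coeff_C_mul, Polynomial.coeff_mul_add_eq_of_natDegree_le h01 (hpow 2),
      Polynomial.coeff_mul_add_eq_of_natDegree_le (hpow 0) (hpow 1), hcoe, hcoe, hcoe,
      eval_monomial, Finsupp.prod_fintype _ _ (by simp), Fin.prod_univ_three]
  have hsum := P.support_sum_monomial_coeff
  constructor
  · rw [← hsum, map_sum]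
    exact Polynomial.natDegree_sum_le_of_forall_le _ _ fun d hd => (hmon d hd).1
  · conv_lhs => rw [← hsum]
    conv_rhs => rw [← hsum]
    rw [map_sum, map_sum, Polynomial.finsetSum_coeff]
    exact Finset.sum_congr rfl fun d hd => (hmon d hd).2

theorem eval_smul_of_isHomogeneous {P : MvPolynomial (Fin 3) ℂ} {n : ℕ}
    (hP : P.IsHomogeneous n) (c : ℂ) (v : Fin 3 → ℂ) : eval (c • v) P = c ^ n * eval v P := by
  rw [eval_eq, eval_eq, Finset.mul_sum]
  refine Finset.sum_congr rfl fun d hd => ?_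
  have hn := sum_exponents_eq_of_isHomogeneous hP hd
  have (f : Fin 3 → ℂ) : ∏ i ∈ d.support, f i ^ d i = ∏ i, f i ^ d i := by
    rw [← Finsupp.prod_fintype d (fun i k => f i ^ k) (by simp)]; rfl
  rw [this, this, Fin.prod_univ_three, Fin.prod_univ_three, ← hn]
  simp only [Pi.smul_apply, smul_eq_mul]
  ring

/-- A binary form of positive degree has a nontrivial zero. -/
theorem exists_zero_on_span {P : MvPolynomial (Fin 3) ℂ} {n : ℕ} (hn : n ≠ 0)
    (hP : P.IsHomogeneous n) {x y : Fin 3 → ℂ} (hxy : x ⨯₃ y ≠ 0) :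
    ∃ a b : ℂ, a • x + b • y ≠ 0 ∧ eval (a • x + b • y) P = 0 := by
  obtain ⟨hdeg, hco⟩ := natDegree_lineRestrict_le_and_coeff hP x y
  by_cases h : (lineRestrict x y P).degree = 0
  · refine ⟨0, 1, ?_, ?_⟩
    · rintro h0
      simp at h0
      simp [h0] at hxy
    · simp only [zero_smul, one_smul, zero_add]
      rw [← hco]
      apply Polynomial.coeff_eq_zero_of_natDegree_lt
      rw [Polynomial.natDegree_eq_of_degree_eq_some h]
      exact Nat.pos_of_ne_zero hn
  · obtain ⟨t, ht⟩ := IsAlgClosed.exists_root _ h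
    refine ⟨1, t, fun h0 => hxy ?_, ?_⟩
    · have : x = -(t • y) := eq_neg_of_add_eq_zero_left (by simpa using h0)
      rw [this]
      simp
    · rw [one_smul, ← eval_lineRestrict]
      exact ht

theorem eval_combination_eq_zero {P : MvPolynomial (Fin 3) ℂ} {n : ℕ}
    (hP : P.IsHomogeneous n) {x y : Fin 3 → ℂ} (h : lineRestrict x y P = 0) (a b : ℂ) :
    eval (a • x + b • y) P = 0 := by
  by_cases ha : a = 0
  · subst ha
    rw [zero_smul, zero_add, eval_smul_of_isHomogeneous hP,
      ← (natDegree_lineRestrict_le_and_coeff hP x y).2, h]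
    simp
  · have : a • x + b • y = a • (x + (b / a) • y) := by
      rw [smul_add, smul_smul, mul_div_cancel₀ _ ha]
    rw [this, eval_smul_of_isHomogeneous hP, ← eval_lineRestrict, h]
    simp

theorem eval_derivative_lineRestrict (x y : Fin 3 → ℂ) (P : MvPolynomial (Fin 3) ℂ) (t : ℂ) :
    (lineRestrict x y P).derivative.eval t = grad P (x + t • y) ⬝ᵥ y := by
  rw [derivative_lineRestrict, Polynomial.eval_finsetSum]
  simp only [Polynomial.eval_mul, Polynomial.eval_C, eval_lineRestrict, dotProduct, grad, mul_comm]

/-- A smooth cubic contains no line. -/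
theorem SmoothCubic.lineRestrict_ne_zero {F : MvPolynomial (Fin 3) ℂ} (hF : SmoothCubic F)
    {x y : Fin 3 → ℂ} (hxy : x ⨯₃ y ≠ 0) : lineRestrict x y F ≠ 0 := by
  intro h
  obtain ⟨m, hm⟩ := Function.ne_iff.mp hxy
  obtain ⟨a, b, hv, h0⟩ := exists_zero_on_span two_ne_zero (hF.1.2.pderiv (i := m)) hxy
  refine hv (hF.2 _ ?_)
  have key (c d : ℂ) : grad F (a • x + b • y) ⬝ᵥ (c • x + d • y) = 0 := by
    have : lineRestrict (a • x + b • y) (c • x + d • y) F = 0 := by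
      refine Polynomial.funext fun t => ?_
      rw [eval_lineRestrict]
      have e : a • x + b • y + t • (c • x + d • y) =
        (a + t * c) • x + (b + t * d) • y := by module
      rw [e, eval_combination_eq_zero hF.1.2 h, Polynomial.eval_zero]
    simpa [this] using (eval_derivative_lineRestrict (a • x + b • y) (c • x + d • y) F 0).symm
  have h1 := eq_smul_cross_of_dotProduct (by simpa using key 1 0)
    (by simpa using key 0 1) hm
  rw [h1]
  have : grad F (a • x + b • y) m = 0 := h0
  simp [this]

end Line

section LinearForms

open Matrix

/-- The linear form with coefficient vector `u`. -/
noncomputable def linForm : (Fin 3 → ℂ) →ₗ[ℂ] MvPolynomial (Fin 3) ℂ :=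
  Fintype.linearCombination ℂ X

theorem eval_linForm (u v : Fin 3 → ℂ) : eval v (linForm u) = u ⬝ᵥ v := by
  simp [linForm, Fintype.linearCombination_apply, dotProduct, smul_eval]

theorem isHomogeneous_linForm (u : Fin 3 → ℂ) : (linForm u).IsHomogeneous 1 := by
  rw [linForm, Fintype.linearCombination_apply]
  refine IsHomogeneous.sum _ _ _ fun i _ => ?_
  rw [smul_eq_C_mul]
  exact isHomogeneous_C_mul_X _ _

theorem grad_linForm_mul (u v : Fin 3 → ℂ) (P : MvPolynomial (Fin 3) ℂ) :
    grad (linForm u * P) v = (u ⬝ᵥ v) • grad P v + eval v P • u := by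
  have hd (i : Fin 3) : pderiv i (linForm u) = C (u i) := by
    simp [linForm, Fintype.linearCombination_apply, Pi.single_apply, smul_eq_C_mul]
  ext i
  simp [grad, Derivation.leibniz, hd, eval_linForm]

theorem exists_forall_dotProduct_ne_zero {ι : Type*} (s : Finset ι) (n : ι → Fin 3 → ℂ)
    (hn : ∀ i ∈ s, n i ≠ 0) : ∃ w : Fin 3 → ℂ, ∀ i ∈ s, n i ⬝ᵥ w ≠ 0 := by
  have hprod : ∏ i ∈ s, linForm (n i) ≠ 0 := by
    refine Finset.prod_ne_zero_iff.mpr fun i hi h0 => hn i hi ?_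
    refine dotProduct_eq_zero _ fun w => ?_
    rw [← eval_linForm, h0, map_zero]
  by_contra! hcon
  refine hprod (MvPolynomial.funext fun w => ?_)
  obtain ⟨i, hi, h0⟩ := hcon w
  rw [map_prod, map_zero]
  exact Finset.prod_eq_zero hi (by rw [eval_linForm, h0])

theorem finite_and_finrank_homogeneousSubmodule_four :
    Module.Finite ℂ (homogeneousSubmodule (Fin 3) ℂ 4) ∧
      Module.finrank ℂ (homogeneousSubmodule (Fin 3) ℂ 4) = 15 := by
  have hs : {d : Fin 3 →₀ ℕ | d.degree = 4} =
      ((Finset.univ : Finset (Fin 3)).finsuppAntidiag 4 : Set (Fin 3 →₀ ℕ)) := by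
    ext d
    simp [Finsupp.degree_eq_sum]
  have e : homogeneousSubmodule (Fin 3) ℂ 4 ≃ₗ[ℂ]
      (((Finset.univ : Finset (Fin 3)).finsuppAntidiag 4 : Set (Fin 3 →₀ ℕ)) →₀ ℂ) := by
    rw [homogeneousSubmodule_eq_finsupp_supported, hs]
    exact AddMonoidAlgebra.supportedEquivFinsupp _
  refine ⟨Module.Finite.equiv e.symm, ?_⟩
  rw [e.finrank_eq, Module.finrank_finsupp_self]
  simp only [Finset.coe_sort_coe, Fintype.card_coe, Finset.card_finsuppAntidiag_nat_eq_choose]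
  rfl

end LinearForms

section NinePoints

open Matrix

variable {F G : MvPolynomial (Fin 3) ℂ} {p : Fin 9 → Fin 3 → ℂ}

theorem NinePoints.cross_ne_zero (hp : NinePoints F G p) {i j : Fin 9} (hij : i ≠ j) :
    p i ⨯₃ p j ≠ 0 :=
  cross_ne_zero_of_not_sameProjPt (hp.1 i) (hp.1 j) (hp.2.1 i j hij)

/-- No four of the nine points are collinear. -/
theorem NinePoints.not_collinear_four (hF : SmoothCubic F) (hp : NinePoints F G p)
    {i j k l : Fin 9} (hij : i ≠ j) (hik : i ≠ k) (hil : i ≠ l) (hjk : j ≠ k) (hjl : j ≠ l)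
    (hkl : k ≠ l) (h1 : p i ⬝ᵥ p j ⨯₃ p k = 0) : p i ⬝ᵥ p j ⨯₃ p l ≠ 0 := by
  intro h2
  have hxy := hp.cross_ne_zero hij
  have main (m : Fin 9) (him : i ≠ m) (hjm : j ≠ m) (h : p i ⬝ᵥ p j ⨯₃ p m = 0) :
      ∃ t c : ℂ, t ≠ 0 ∧ c ≠ 0 ∧ c • (p i + t • p j) = p m := by
    rw [triple_product_permutation, triple_product_permutation] at h
    obtain ⟨a, b, hab⟩ := exists_eq_smul_add_smul_of_dotProduct_cross hxy h
    have ha : a ≠ 0 := by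
      rintro rfl
      refine hp.2.1 j m hjm ⟨b, ?_, by simp [hab]⟩
      rintro rfl
      exact hp.1 m (by simp [hab])
    have hb : b ≠ 0 := by
      rintro rfl
      exact hp.2.1 i m him ⟨a, ha, by simp [hab]⟩
    exact ⟨b / a, a, div_ne_zero hb ha, ha, by
      rw [hab, smul_add, smul_smul, mul_div_cancel₀ _ ha]⟩
  have root {m : Fin 9} {t c : ℂ} (hc : c ≠ 0) (h : c • (p i + t • p j) = p m) :
      (lineRestrict (p i) (p j) F).eval t = 0 := by
    have := (hp.2.2.1 m).1
    rw [← h, eval_smul_of_isHomogeneous hF.1.2] at this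
    rw [eval_lineRestrict]
    exact (mul_eq_zero.mp this).resolve_left (pow_ne_zero _ hc)
  obtain ⟨t, c, ht, hc, hk⟩ := main k hik hjk h1
  obtain ⟨t', c', ht', hc', hl⟩ := main l hil hjl h2
  have htt : t ≠ t' := by
    rintro rfl
    refine hp.2.1 k l hkl ⟨c' / c, div_ne_zero hc' hc, ?_⟩
    rw [← hk, smul_smul, div_mul_cancel₀ _ hc, hl]
  obtain ⟨hdeg, hco⟩ := natDegree_lineRestrict_le_and_coeff hF.1.2 (p i) (p j)
  rw [(hp.2.2.1 j).1] at hco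
  have hcard : ({0, t, t'} : Finset ℂ).card = 3 := by
    rw [Finset.card_eq_three]
    exact ⟨0, t, t', ht.symm, ht'.symm, htt, rfl⟩
  refine hF.lineRestrict_ne_zero hxy
    (Polynomial.eq_zero_of_natDegree_lt_card_of_eval_eq_zero' _ {0, t, t'} ?_ ?_)
  · intro s hs
    simp only [Finset.mem_insert, Finset.mem_singleton] at hs
    rcases hs with rfl | rfl | rfl
    · exact root (m := i) one_ne_zero (by simp)
    · exact root hc hk
    · exact root hc' hl
  · rw [hcard]
    refine lt_of_le_of_ne hdeg fun h3 => hF.lineRestrict_ne_zero hxy ?_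
    rw [← Polynomial.leadingCoeff_eq_zero, Polynomial.leadingCoeff, h3, hco]

/-- Four of the points can be separated from a fifth by a pair of lines. -/
theorem NinePoints.exists_conic (hF : SmoothCubic F) (hp : NinePoints F G p) (i : Fin 9)
    {e : Fin 4 → Fin 9} (he : Function.Injective e) (hi : ∀ k, i ≠ e k) :
    ∃ Q : MvPolynomial (Fin 3) ℂ, Q.IsHomogeneous 2 ∧ (∀ k, eval (p (e k)) Q = 0) ∧
      eval (p i) Q ≠ 0 := by
  have hbad {a b c : Fin 4} (hab : a ≠ b) (hac : a ≠ c) (hbc : b ≠ c)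
      (h : p i ⬝ᵥ p (e a) ⨯₃ p (e b) = 0) : p i ⬝ᵥ p (e a) ⨯₃ p (e c) ≠ 0 :=
    hp.not_collinear_four hF (hi a) (hi b) (hi c) (he.ne hab) (he.ne hac) (he.ne hbc) h
  have hsymm {a b : Fin 4} (h : p i ⬝ᵥ p (e a) ⨯₃ p (e b) = 0) :
      p i ⬝ᵥ p (e b) ⨯₃ p (e a) = 0 := by
    rw [← cross_anticomm, dotProduct_neg, h, neg_zero]
  suffices h : ∃ a b c d : Fin 4, (∀ k, k = a ∨ k = b ∨ k = c ∨ k = d) ∧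
      p i ⬝ᵥ p (e a) ⨯₃ p (e b) ≠ 0 ∧ p i ⬝ᵥ p (e c) ⨯₃ p (e d) ≠ 0 by
    obtain ⟨a, b, c, d, hk, hab, hcd⟩ := h
    refine ⟨linForm (p (e a) ⨯₃ p (e b)) * linForm (p (e c) ⨯₃ p (e d)),
      (isHomogeneous_linForm _).mul (isHomogeneous_linForm _), fun k => ?_, ?_⟩
    · rw [map_mul, eval_linForm, eval_linForm, dotProduct_comm, dotProduct_comm _ (p (e k))]
      rcases hk k with rfl | rfl | rfl | rfl <;> simp
    · rw [map_mul, eval_linForm, eval_linForm, dotProduct_comm, dotProduct_comm _ (p i)]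
      exact mul_ne_zero hab hcd
  by_cases h01 : p i ⬝ᵥ p (e 0) ⨯₃ p (e 1) = 0
  · exact ⟨0, 2, 1, 3, by decide, hbad (by decide) (by decide) (by decide) h01,
      hbad (by decide) (by decide) (by decide) (hsymm h01)⟩
  by_cases h23 : p i ⬝ᵥ p (e 2) ⨯₃ p (e 3) = 0
  · exact ⟨2, 0, 3, 1, by decide, hbad (by decide) (by decide) (by decide) h23,
      hbad (by decide) (by decide) (by decide) (hsymm h23)⟩
  exact ⟨0, 1, 2, 3, by decide, h01, h23⟩

/-- Quartics separate the nine points. -/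
theorem NinePoints.exists_quartic (hF : SmoothCubic F) (hp : NinePoints F G p) (i : Fin 9) :
    ∃ K : MvPolynomial (Fin 3) ℂ, K.IsHomogeneous 4 ∧ (∀ k, k ≠ i → eval (p k) K = 0) ∧
      eval (p i) K ≠ 0 := by
  obtain ⟨Q, hQ, hQ0, hQi⟩ := hp.exists_conic hF i (e := fun k => i.succAbove (Fin.castAdd 4 k))
    (i.succAbove_right_injective.comp (Fin.castAdd_injective 4 4))
    fun k => (Fin.succAbove_ne i _).symm
  obtain ⟨R, hR, hR0, hRi⟩ := hp.exists_conic hF i (e := fun k => i.succAbove (Fin.natAdd 4 k))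
    (i.succAbove_right_injective.comp (Fin.natAdd_injective 4 4))
    fun k => (Fin.succAbove_ne i _).symm
  refine ⟨Q * R, hQ.mul hR, fun k hk => ?_, by rw [map_mul]; exact mul_ne_zero hQi hRi⟩
  obtain ⟨m, rfl⟩ := Fin.exists_succAbove_eq hk
  rw [map_mul]
  induction m using Fin.addCases (m := 4) (n := 4) with
  | left m => rw [hQ0 m, zero_mul]
  | right m => rw [hR0 m, mul_zero]

theorem NinePoints.grad_combination (hp : NinePoints F G p) (i : Fin 9) (a b : Fin 3 → ℂ) :
    grad (linForm a * F + linForm b * G) (p i) =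
      (a ⬝ᵥ p i) • grad F (p i) + (b ⬝ᵥ p i) • grad G (p i) := by
  have hadd (P Q : MvPolynomial (Fin 3) ℂ) (v) : grad (P + Q) v = grad P v + grad Q v := by
    ext
    simp [grad]
  rw [hadd, grad_linForm_mul, grad_linForm_mul, (hp.2.2.1 i).1, (hp.2.2.1 i).2, zero_smul,
    zero_smul, add_zero, add_zero]

theorem NinePoints.eq_zero_of_forall_dotProduct (hF : SmoothCubic F) (hp : NinePoints F G p)
    {a : Fin 3 → ℂ} (h : ∀ i, a ⬝ᵥ p i = 0) : a = 0 := by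
  have hdet {k : Fin 9} (hk : p 0 ⬝ᵥ p 1 ⨯₃ p k ≠ 0) : a = 0 := by
    rw [triple_product_eq_det] at hk
    refine eq_zero_of_mulVec_eq_zero hk (funext fun i => ?_)
    fin_cases i <;> simp [mulVec, dotProduct_comm _ a, h]
  by_cases h2 : p 0 ⬝ᵥ p 1 ⨯₃ p 2 = 0
  · exact hdet (k := 3) (hp.not_collinear_four hF (by decide) (by decide) (by decide) (by decide)
      (by decide) (by decide) h2)
  · exact hdet h2

/-- A special case of Max Noether's theorem: a quartic through the nine points lies in the
ideal generated by the two cubics. -/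
theorem NinePoints.exists_eq_combination (hF : SmoothCubic F) (hG : SmoothCubic G)
    (hp : NinePoints F G p) (htrans : ∀ i, Transverse F G (p i)) {K : MvPolynomial (Fin 3) ℂ}
    (hK : K.IsHomogeneous 4) (hK0 : ∀ i, eval (p i) K = 0) :
    ∃ a b : Fin 3 → ℂ, K = linForm a * F + linForm b * G := by
  obtain ⟨_, hrank⟩ := finite_and_finrank_homogeneousSubmodule_four
  let ev : homogeneousSubmodule (Fin 3) ℂ 4 →ₗ[ℂ] (Fin 9 → ℂ) :=
    LinearMap.pi fun i => (aeval (p i)).toLinearMap ∘ₗ Submodule.subtype _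
  have hev (Q : homogeneousSubmodule (Fin 3) ℂ 4) (i : Fin 9) : ev Q i = eval (p i) Q.1 := by
    simp [ev, aeval_eq_eval]
  let Φ : (Fin 3 → ℂ) × (Fin 3 → ℂ) →ₗ[ℂ] homogeneousSubmodule (Fin 3) ℂ 4 :=
    LinearMap.codRestrict _
      (((LinearMap.mulRight ℂ F).comp linForm).coprod ((LinearMap.mulRight ℂ G).comp linForm))
      fun c => ((isHomogeneous_linForm c.1).mul hF.1.2).add
        ((isHomogeneous_linForm c.2).mul hG.1.2)
  have hΦ (c) : (Φ c : MvPolynomial (Fin 3) ℂ) = linForm c.1 * F + linForm c.2 * G := rfl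
  have hinj : Function.Injective Φ := by
    rw [injective_iff_map_eq_zero]
    intro c hc
    have h0 : linForm c.1 * F + linForm c.2 * G = 0 := by rw [← hΦ, hc]; rfl
    have hz (i : Fin 9) : c.1 ⬝ᵥ p i = 0 ∧ c.2 ⬝ᵥ p i = 0 := by
      refine LinearIndependent.pair_iff.mp (htrans i) _ _ ?_
      rw [← hp.grad_combination, h0]
      ext
      simp [grad]
    exact Prod.ext (hp.eq_zero_of_forall_dotProduct hF fun i => (hz i).1)
      (hp.eq_zero_of_forall_dotProduct hF fun i => (hz i).2)
  have hsurj : Function.Surjective ev := by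
    choose Q hQ hQ0 hQi using hp.exists_quartic hF
    intro f
    refine ⟨∑ i, (f i / eval (p i) (Q i)) • ⟨Q i, hQ i⟩, funext fun k => ?_⟩
    rw [map_sum, Finset.sum_apply, Finset.sum_eq_single k]
    · rw [map_smul, Pi.smul_apply, hev, smul_eq_mul, div_mul_cancel₀ _ (hQi k)]
    · intro i _ hik
      rw [map_smul, Pi.smul_apply, hev, hQ0 i k hik.symm, smul_zero]
    · simp
  have hle : LinearMap.range Φ ≤ LinearMap.ker ev := by
    rintro _ ⟨c, rfl⟩
    refine LinearMap.mem_ker.mpr (funext fun i => ?_)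
    rw [hev, hΦ]
    simp [(hp.2.2.1 i).1, (hp.2.2.1 i).2]
  have hrange : LinearMap.range Φ = LinearMap.ker ev := by
    refine Submodule.eq_of_le_of_finrank_le hle ?_
    have h1 := LinearMap.finrank_range_add_finrank_ker ev
    have h2 := LinearMap.finrank_range_of_inj hinj
    rw [LinearMap.range_eq_top.mpr hsurj, finrank_top, hrank] at h1
    simp at h1 h2
    omega
  have hmem : (⟨K, hK⟩ : homogeneousSubmodule (Fin 3) ℂ 4) ∈ LinearMap.range Φ := by
    rw [hrange, LinearMap.mem_ker]
    exact funext fun i => by rw [hev, hK0, Pi.zero_apply]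
  obtain ⟨c, hc⟩ := hmem
  exact ⟨c.1, c.2, by rw [← hΦ, hc]⟩

end NinePoints

section Syzygy

/-- Polynomials `f`, `g` of degree at most `3`, not both of smaller degree, whose only common root
is a transversal one at `0`, admit no nontrivial syzygy with coefficients of degree at most `1`. -/
theorem eq_zero_of_linear_syzygy {a b f g : Polynomial ℂ} (ha : a.natDegree ≤ 1)
    (hb : b.natDegree ≤ 1) (hf0 : f.eval 0 = 0) (hg0 : g.eval 0 = 0)
    (hroot : ∀ t, f.eval t = 0 → g.eval t = 0 → t = 0)
    (hder : ¬ (f.derivative.eval 0 = 0 ∧ g.derivative.eval 0 = 0))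
    (hlead : ¬ (f.coeff 3 = 0 ∧ g.coeff 3 = 0)) (h : a * f + b * g = 0) : a = 0 ∧ b = 0 := by
  obtain ⟨f', rfl⟩ : Polynomial.X ∣ f := by
    rwa [Polynomial.X_dvd_iff, Polynomial.coeff_zero_eq_eval_zero]
  obtain ⟨g', rfl⟩ : Polynomial.X ∣ g := by
    rwa [Polynomial.X_dvd_iff, Polynomial.coeff_zero_eq_eval_zero]
  simp only [Polynomial.derivative_mul, Polynomial.derivative_X, one_mul, Polynomial.eval_add,
    Polynomial.eval_mul, Polynomial.eval_X, zero_mul, add_zero, mul_eq_zero] at hder hroot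
  rw [Polynomial.coeff_X_mul, Polynomial.coeff_X_mul] at hlead
  have hcop : IsCoprime f' g' := by
    rw [Polynomial.isCoprime_iff_aeval_ne_zero_of_isAlgClosed ℂ ℂ]
    intro t
    by_contra! hcon
    simp only [Polynomial.coe_aeval_eq_eval] at hcon
    obtain rfl := hroot t (Or.inr hcon.1) (Or.inr hcon.2)
    exact hder hcon
  have h' : a * f' + b * g' = 0 :=
    (mul_eq_zero.mp (show Polynomial.X * (a * f' + b * g') = 0 by
      linear_combination h)).resolve_left Polynomial.X_ne_zero
  have hfb : f' ∣ b := hcop.dvd_of_dvd_mul_right ⟨-a, by linear_combination h'⟩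
  have hga : g' ∣ a := hcop.symm.dvd_of_dvd_mul_right ⟨-b, by linear_combination h'⟩
  have hdeg {q c : Polynomial ℂ} (hq : q.coeff 2 ≠ 0) (hc : c.natDegree ≤ 1) (hqc : q ∣ c) :
      q ≠ 0 ∧ c = 0 :=
    ⟨by rintro rfl; simp at hq, Polynomial.eq_zero_of_dvd_of_natDegree_lt hqc
      (hc.trans_lt (Polynomial.le_natDegree_of_ne_zero hq))⟩
  by_cases hf2 : f'.coeff 2 = 0
  · obtain ⟨hg', rfl⟩ := hdeg (fun hg2 => hlead ⟨hf2, hg2⟩) ha hga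
    exact ⟨rfl, by simpa [hg'] using h'⟩
  · obtain ⟨hf', rfl⟩ := hdeg hf2 hb hfb
    exact ⟨by simpa [hf'] using h', rfl⟩

end Syzygy

section GenericLine

open Matrix

variable {F G : MvPolynomial (Fin 3) ℂ} {p : Fin 9 → Fin 3 → ℂ}

/-- There is a line through `p j` missing the other eight points. -/
theorem NinePoints.exists_generic_direction (hp : NinePoints F G p) (j : Fin 9) :
    ∃ w : Fin 3 → ℂ, p j ⨯₃ w ≠ 0 ∧
      ∀ s t : ℂ, s • p j + t • w ≠ 0 → eval (s • p j + t • w) F = 0 →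
        eval (s • p j + t • w) G = 0 → t = 0 := by
  obtain ⟨w, hw⟩ := exists_forall_dotProduct_ne_zero (Finset.univ.erase j)
    (fun i => p j ⨯₃ p i) fun i hi => hp.cross_ne_zero (Finset.ne_of_mem_erase hi).symm
  obtain ⟨i₀, hi₀⟩ := exists_ne j
  have hmul (s t : ℂ) (i : Fin 9) :
      (p j ⨯₃ p i) ⬝ᵥ (s • p j + t • w) = t * ((p j ⨯₃ p i) ⬝ᵥ w) := by
    rw [dotProduct_add, dotProduct_smul, dotProduct_smul, dotProduct_comm _ (p j),
      dot_self_cross]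
    simp
  refine ⟨w, fun h0 => hw i₀ (by simpa using hi₀) ?_, fun s t hne hF0 hG0 => ?_⟩
  · rw [dotProduct_comm, triple_product_permutation, triple_product_permutation,
      ← cross_anticomm (p j) w, h0, neg_zero, dotProduct_zero]
  · obtain ⟨i, c, -, hc⟩ := hp.2.2.2 _ hne hF0 hG0
    have key (k : Fin 9) (hk : k ≠ j) (h : (p j ⨯₃ p k) ⬝ᵥ p i = 0) : t = 0 := by
      have := hmul s t k
      rw [← hc, dotProduct_smul, h, smul_zero] at this
      exact (mul_eq_zero.mp this.symm).resolve_right (hw k (by simpa using hk))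
    by_cases hij : i = j
    · subst hij
      exact key i₀ hi₀ (by rw [dotProduct_comm, dot_self_cross])
    · exact key i hij (by rw [dotProduct_comm, dot_cross_self])

/-- A syzygy of `F` and `G` modulo the equation of the line has coefficients vanishing at `p j`. -/
theorem NinePoints.dotProduct_eq_zero_of_syzygy (hF : SmoothCubic F) (hG : SmoothCubic G)
    (hp : NinePoints F G p) {j : Fin 9} (htrans : Transverse F G (p j)) {w a b : Fin 3 → ℂ}
    (hw : p j ⨯₃ w ≠ 0)
    (hgen : ∀ s t : ℂ, s • p j + t • w ≠ 0 → eval (s • p j + t • w) F = 0 →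
      eval (s • p j + t • w) G = 0 → t = 0)
    (h : lineRestrict (p j) w (linForm a * F + linForm b * G) = 0) :
    a ⬝ᵥ p j = 0 ∧ b ⬝ᵥ p j = 0 := by
  have hw0 : w ≠ 0 := by
    rintro rfl
    simp at hw
  have hcoeff {P : MvPolynomial (Fin 3) ℂ} (hP : SmoothCubic P) :=
    (natDegree_lineRestrict_le_and_coeff hP.1.2 (p j) w).2
  have hder (P : MvPolynomial (Fin 3) ℂ) :
      (lineRestrict (p j) w P).derivative.eval 0 = grad P (p j) ⬝ᵥ w := by
    simpa using eval_derivative_lineRestrict (p j) w P 0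
  have heuler {P : MvPolynomial (Fin 3) ℂ} (hP : SmoothCubic P) (h0 : eval (p j) P = 0) :
      grad P (p j) ⬝ᵥ p j = 0 := by
    have := congrArg (eval (p j)) hP.1.2.sum_X_mul_pderiv
    simpa [h0, dotProduct, grad, mul_comm] using this
  obtain ⟨hF0, hG0⟩ := hp.2.2.1 j
  rw [map_add, map_mul, map_mul] at h
  have := eq_zero_of_linear_syzygy
    (natDegree_lineRestrict_le_and_coeff (isHomogeneous_linForm a) (p j) w).1
    (natDegree_lineRestrict_le_and_coeff (isHomogeneous_linForm b) (p j) w).1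
    (by simpa [eval_lineRestrict] using hF0) (by simpa [eval_lineRestrict] using hG0)
    (fun t hft hgt => ?_) ?_ ?_ h
  · constructor
    · simpa [eval_lineRestrict, eval_linForm] using congrArg (Polynomial.eval 0) this.1
    · simpa [eval_lineRestrict, eval_linForm] using congrArg (Polynomial.eval 0) this.2
  · rw [eval_lineRestrict] at hft hgt
    refine hgen 1 t (fun h0 => hw ?_) (by rwa [one_smul]) (by rwa [one_smul])
    rw [one_smul] at h0
    rw [eq_neg_of_add_eq_zero_left h0]
    simp
  · rw [hder, hder]
    rintro ⟨hFw, hGw⟩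
    obtain ⟨m, hm⟩ := Function.ne_iff.mp hw
    have h1 := eq_smul_cross_of_dotProduct (heuler hF hF0) hFw hm
    have h2 := eq_smul_cross_of_dotProduct (heuler hG hG0) hGw hm
    generalize grad F (p j) m / (p j ⨯₃ w) m = c at h1
    generalize grad G (p j) m / (p j ⨯₃ w) m = d at h2
    have h3 := LinearIndependent.pair_iff.mp htrans d (-c) (by rw [h1, h2]; module)
    have hc : c = 0 := by simpa using h3.2
    rw [hc, zero_smul] at h1
    exact hp.1 j (hF.2 _ h1)
  · rw [hcoeff hF, hcoeff hG]
    rintro ⟨hFw, hGw⟩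
    exact one_ne_zero (hgen 0 1 (by simpa using hw0) (by simpa using hFw) (by simpa using hGw))

end GenericLine

/-- If a cubic `H` vanishes at eight of the nine transversal intersection
points of two smooth cubics `F` and `G`, then it also vanishes at the ninth. -/
theorem cubic_through_eight_points_passes_through_ninth
    (F G : MvPolynomial (Fin 3) ℂ) (hF : SmoothCubic F) (hG : SmoothCubic G)
    (p : Fin 9 → Fin 3 → ℂ) (hp : NinePoints F G p)
    (htrans : ∀ i, Transverse F G (p i))
    (H : MvPolynomial (Fin 3) ℂ) (hH : IsCubic H)
    (j : Fin 9) (hvan : ∀ i, i ≠ j → eval (p i) H = 0) :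
    eval (p j) H = 0 := by
  obtain ⟨w, hw, hgen⟩ := hp.exists_generic_direction j
  set u := crossProduct (p j) w with hu
  have huj : dotProduct u (p j) = 0 := by rw [dotProduct_comm, hu, dot_self_cross]
  obtain ⟨a, b, hab⟩ := hp.exists_eq_combination hF hG htrans (K := linForm u * H)
    ((isHomogeneous_linForm u).mul hH.2) fun i => by
      rw [map_mul, eval_linForm]
      by_cases hij : i = j
      · rw [hij, huj, zero_mul]
      · rw [hvan i hij, mul_zero]
  have hline : lineRestrict (p j) w (linForm a * F + linForm b * G) = 0 := by
    rw [← hab]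
    refine Polynomial.funext fun t => ?_
    rw [eval_lineRestrict, map_mul, eval_linForm, dotProduct_add, huj, dotProduct_smul,
      dotProduct_comm u w, hu, dot_cross_self]
    simp
  obtain ⟨ha, hb⟩ := hp.dotProduct_eq_zero_of_syzygy hF hG (htrans j) hw hgen hline
  have hgrad := hp.grad_combination j a b
  rw [← hab, grad_linForm_mul, huj, ha, hb, zero_smul, zero_smul, zero_smul, zero_add,
    zero_add] at hgrad
  exact (smul_eq_zero.mp hgrad).resolve_right hw
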